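/- arXiv:1409.0501 — 3 statements merged into one kernel-verified Lean document; each statement's English description precedes it below -/
import Mathlib

section
/- Let f : ℝⁿ → ℝⁿ be a smooth injective immersion (by the inverse function theorem, such a map is automatically a smooth open embedding). Then there is a smooth map H : ℝ × ℝⁿ → ℝⁿ such that H(0,·) = f, H(1,·) is an orthogonal linear transformation of ℝⁿ, and for every t ∈ [0,1] the map H(t,·) : ℝⁿ → ℝⁿ is a smooth injective immersion. In particular, every smooth open embedding of ℝⁿ into itself with everywhere injective derivative is smoothly isotopic, through such embeddings, to an element of the orthogonal group O(n). -/
open scoped RealInnerProductSpace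

open MeasureTheory Set

/-- Differentiation under the integral sign, to all orders: the integral over `[0, 1]` of a smooth
function depends smoothly on the parameter. -/
theorem contDiff_intervalIntegral_param {P F : Type*} [NormedAddCommGroup P] [NormedSpace ℝ P]
    [NormedAddCommGroup F] [NormedSpace ℝ F] [CompleteSpace F] {n : ℕ∞} {φ : P × ℝ → F}
    (hφ : ContDiff ℝ n φ) : ContDiff ℝ n fun p => ∫ s in (0 : ℝ)..1, φ (p, s) := by
  let χ : ContDiffBump (0 : ℝ) := ⟨1, 2, one_pos, one_lt_two⟩
  let g : P → ℝ → F := fun p s => χ s • φ (p, -s)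
  let u : ℝ → ℝ := (Ioc 0 1).indicator 1
  have hu : LocallyIntegrable u volume :=
    ((integrable_indicator_iff measurableSet_Ioc).2
      (integrableOn_const (by simp) (by simp))).locallyIntegrable
  have hg : ContDiff ℝ n ↿g := by
    have h₁ : ContDiff ℝ n fun q : P × ℝ => χ q.2 := χ.contDiff.comp contDiff_snd
    have h₂ : ContDiff ℝ n fun q : P × ℝ => φ (q.1, -q.2) :=
      hφ.comp (contDiff_fst.prodMk contDiff_snd.neg)
    exact h₁.smul h₂
  have hsupp : ∀ p, ∀ x, p ∈ (univ : Set P) → x ∉ Metric.closedBall (0 : ℝ) 2 → g p x = 0 := by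
    intro p x _ hx
    have hχ : χ x = 0 := χ.zero_of_le_dist (le_of_lt (by simpa using hx))
    simp [g, hχ]
  have hconv := contDiffOn_convolution_right_with_param (μ := volume)
    (ContinuousLinearMap.lsmul ℝ ℝ) isOpen_univ (isCompact_closedBall (0 : ℝ) 2) hsupp hu
    hg.contDiffOn
  rw [univ_prod_univ, contDiffOn_univ] at hconv
  convert hconv.comp (contDiff_id.prodMk (contDiff_const (c := (0 : ℝ)))) using 2 with p
  rw [intervalIntegral.integral_of_le zero_le_one, ← integral_indicator measurableSet_Ioc]
  refine integral_congr_ae (.of_forall fun s => ?_)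
  by_cases hs : s ∈ Ioc (0 : ℝ) 1
  · have hχ : χ (-s) = 1 := χ.one_of_mem_closedBall (by
      simpa [χ, abs_le] using ⟨by linarith [hs.1], hs.2⟩)
    simp [u, g, hs, hχ]
  · simp [u, hs]

/-- **Hadamard's lemma**, along lines through the origin. -/
theorem exists_contDiff_eq_add_smul {E F : Type*} [NormedAddCommGroup E] [NormedSpace ℝ E]
    [NormedAddCommGroup F] [NormedSpace ℝ F] [CompleteSpace F] {f : E → F}
    (hf : ContDiff ℝ (⊤ : ℕ∞) f) :
    ∃ g : ℝ × E → F, ContDiff ℝ (⊤ : ℕ∞) g ∧ (∀ x, g (0, x) = fderiv ℝ f 0 x) ∧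
      ∀ t x, f (t • x) = f 0 + t • g (t, x) := by
  have hf' : ContDiff ℝ (⊤ : ℕ∞) (fderiv ℝ f) := hf.fderiv_right (by simp)
  refine ⟨fun p => ∫ s in (0 : ℝ)..1, fderiv ℝ f (s • p.1 • p.2) p.2, ?_, by simp, fun t x => ?_⟩
  · have hφ : ContDiff ℝ (⊤ : ℕ∞) fun q : (ℝ × E) × ℝ =>
        fderiv ℝ f (q.2 • q.1.1 • q.1.2) q.1.2 :=
      (hf'.comp (by fun_prop)).clm_apply (by fun_prop)
    exact contDiff_intervalIntegral_param hφ
  · have hd : ∀ s ∈ uIcc (0 : ℝ) 1, HasDerivAt (fun s : ℝ => f (s • t • x))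
        (fderiv ℝ f (s • t • x) (t • x)) s := fun s _ => by
      have h := ((hf.differentiable (by simp)) (s • t • x)).hasFDerivAt.comp_hasDerivAt s
        ((hasDerivAt_id s).smul_const (t • x))
      simpa [Function.comp_def] using h
    have hc : Continuous fun s : ℝ => fderiv ℝ f (s • t • x) (t • x) :=
      (hf'.continuous.comp (by fun_prop)).clm_apply continuous_const
    have h := intervalIntegral.integral_eq_sub_of_hasDerivAt hd (hc.intervalIntegrable 0 1)
    simp only [map_smul, intervalIntegral.integral_smul, one_smul, zero_smul] at h
    simp [h]

/-- The segment joining an injective endomorphism to the orthogonal factor of its polar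
decomposition consists of injective endomorphisms. -/
theorem exists_linearIsometry_segment_injective {E : Type*} [NormedAddCommGroup E]
    [InnerProductSpace ℝ E] [FiniteDimensional ℝ E] (L : E →ₗ[ℝ] E)
    (hL : Function.Injective L) :
    ∃ Q : E →ₗᵢ[ℝ] E, ∀ t ∈ Icc (0 : ℝ) 1,
      Function.Injective (L + t • (Q.toLinearMap - L)) := by
  have hsym : (L.adjoint ∘ₗ L).IsSymmetric := fun x y => by
    simp [LinearMap.adjoint_inner_left, LinearMap.adjoint_inner_right]
  let b := hsym.eigenvectorBasis rfl
  let μ := hsym.eigenvalues rfl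
  have hinner : ∀ i j, ⟪L (b i), L (b j)⟫ = if i = j then μ i else 0 := fun i j => by
    have h : L.adjoint (L (b i)) = μ i • b i := hsym.apply_eigenvectorBasis rfl i
    rw [← LinearMap.adjoint_inner_left, h, real_inner_smul_left,
      orthonormal_iff_ite.1 b.orthonormal, mul_ite, mul_one, mul_zero]
  have hμ : ∀ i, 0 < μ i := fun i => by
    have h := hinner i i
    rw [if_pos rfl] at h
    rw [← h, real_inner_self_pos]
    exact (map_ne_zero_iff L hL).2 (b.orthonormal.ne_zero i)
  let r := fun i => √(μ i)
  have hr : ∀ i, 0 < r i := fun i => Real.sqrt_pos.2 (hμ i)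
  let v := fun i => (r i)⁻¹ • L (b i)
  have hLv : ∀ i, L (b i) = r i • v i := fun i => (smul_inv_smul₀ (hr i).ne' _).symm
  have hv : Orthonormal ℝ v := orthonormal_iff_ite.2 fun i j => by
    simp only [v, real_inner_smul_left, real_inner_smul_right, hinner]
    split_ifs with h
    · subst h
      have h : r i * r i = μ i := Real.mul_self_sqrt (hμ i).le
      have := (hr i).ne'
      rw [← h]
      field_simp
    · simp
  let Q : E →ₗᵢ[ℝ] E := (b.toBasis.constr ℝ v).isometryOfOrthonormal
    (v := b.toBasis) (by simp) (by
      convert hv using 1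
      ext1 i
      exact b.toBasis.constr_basis ℝ v i)
  have hQ : ∀ i, Q (b i) = v i := fun i => by
    have h := b.toBasis.constr_basis ℝ v i
    rwa [b.coe_toBasis] at h
  refine ⟨Q, fun t ht => (injective_iff_map_eq_zero _).2 fun x hx => ?_⟩
  have hb : ∀ i, (L + t • (Q.toLinearMap - L)) (b i) = (r i + t * (1 - r i)) • v i := fun i => by
    have h : Q.toLinearMap (b i) = v i := hQ i
    simp only [LinearMap.add_apply, LinearMap.smul_apply, LinearMap.sub_apply, h, hLv]
    module
  have hpos : ∀ i, 0 < r i + t * (1 - r i) := fun i => by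
    rcases ht.1.eq_or_lt with rfl | h
    · simpa using hr i
    · nlinarith [mul_nonneg (sub_nonneg.2 ht.2) (hr i).le]
  rw [← b.sum_repr x, map_sum] at hx
  simp only [map_smul, hb, smul_smul] at hx
  have hz := Fintype.linearIndependent_iff.1 hv.linearIndependent _ hx
  rw [← b.sum_repr x]
  refine Finset.sum_eq_zero fun i _ => ?_
  rw [(mul_eq_zero.1 (hz i)).resolve_right (hpos i).ne', zero_smul]


/-- **Smooth open self-embeddings of `ℝⁿ` are isotopic to orthogonal transformations.**
Let `f : ℝⁿ → ℝⁿ` be a smooth injective immersion.  Then there is a smooth map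
`H : ℝ × ℝⁿ → ℝⁿ` with `H 0 = f`, with `H 1` an orthogonal linear transformation (a linear
map preserving the standard inner product), and with `H t` a smooth injective immersion for
every `t ∈ [0,1]`. -/
theorem smooth_embedding_isotopic_to_orthogonal
    {n : ℕ} (f : EuclideanSpace ℝ (Fin n) → EuclideanSpace ℝ (Fin n))
    (hf : ContDiff ℝ (⊤ : ℕ∞) f)
    (hinj : Function.Injective f)
    (himm : ∀ x, Function.Injective (fderiv ℝ f x)) :
    ∃ H : ℝ × EuclideanSpace ℝ (Fin n) → EuclideanSpace ℝ (Fin n),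
      ContDiff ℝ (⊤ : ℕ∞) H ∧
      (∀ x, H (0, x) = f x) ∧
      (∃ A : EuclideanSpace ℝ (Fin n) →ₗ[ℝ] EuclideanSpace ℝ (Fin n),
        (∀ x y, ⟪A x, A y⟫ = ⟪x, y⟫) ∧ ∀ x, H (1, x) = A x) ∧
      (∀ t ∈ Set.Icc (0 : ℝ) 1,
        ContDiff ℝ (⊤ : ℕ∞) (fun x => H (t, x)) ∧
        Function.Injective (fun x => H (t, x)) ∧
        ∀ x, Function.Injective (fderiv ℝ (fun y => H (t, y)) x)) := by
  obtain ⟨g, hg, hg₀, hfg⟩ := exists_contDiff_eq_add_smul hf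
  obtain ⟨Q, hQ⟩ := exists_linearIsometry_segment_injective
    (fderiv ℝ f 0 : EuclideanSpace ℝ (Fin n) →ₗ[ℝ] EuclideanSpace ℝ (Fin n)) (himm 0)
  let σ := Real.smoothTransition
  let a : ℝ → ℝ := fun t => 1 - σ (2 * t)
  let c : ℝ → ℝ := fun t => σ (2 * t - 1)
  have hσ : ContDiff ℝ (⊤ : ℕ∞) σ := Real.smoothTransition.contDiff
  let H : ℝ × EuclideanSpace ℝ (Fin n) → EuclideanSpace ℝ (Fin n) := fun p =>
    g (a p.1, p.2) + a p.1 • f 0 + c p.1 • (Q p.2 - fderiv ℝ f 0 p.2)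
  have ha : ContDiff ℝ (⊤ : ℕ∞) a := contDiff_const.sub (hσ.comp (by fun_prop))
  have hc : ContDiff ℝ (⊤ : ℕ∞) c := hσ.comp (by fun_prop)
  have hH : ContDiff ℝ (⊤ : ℕ∞) H := by
    have hQ' : ContDiff ℝ (⊤ : ℕ∞) Q := Q.contDiff
    have h₁ : ContDiff ℝ (⊤ : ℕ∞) fun p : ℝ × EuclideanSpace ℝ (Fin n) => g (a p.1, p.2) :=
      hg.comp ((ha.comp contDiff_fst).prodMk contDiff_snd)
    have h₂ : ContDiff ℝ (⊤ : ℕ∞) fun p : ℝ × EuclideanSpace ℝ (Fin n) =>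
        Q p.2 - fderiv ℝ f 0 p.2 := by fun_prop
    exact (h₁.add ((ha.comp contDiff_fst).smul contDiff_const)).add
      ((hc.comp contDiff_fst).smul h₂)
  refine ⟨H, hH, fun x => ?_, ⟨Q.toLinearMap, Q.inner_map_map, fun x => ?_⟩, fun t ht =>
    ⟨hH.comp (contDiff_const.prodMk contDiff_id), ?_⟩⟩
  · have ha₀ : a 0 = 1 := by simp [a, σ]
    have hc₀ : c 0 = 0 := Real.smoothTransition.zero_of_nonpos (by norm_num)
    have h := hfg 1 x
    rw [one_smul, one_smul] at h
    simp [H, ha₀, hc₀, h, add_comm]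
  · have ha₁ : a 1 = 0 := sub_eq_zero.2 (Real.smoothTransition.one_of_one_le (by norm_num)).symm
    have hc₁ : c 1 = 1 := Real.smoothTransition.one_of_one_le (by norm_num)
    simp [H, ha₁, hc₁, hg₀]
  by_cases hat : a t = 0
  · let M : EuclideanSpace ℝ (Fin n) →L[ℝ] EuclideanSpace ℝ (Fin n) :=
      fderiv ℝ f 0 + c t • (Q.toContinuousLinearMap - fderiv ℝ f 0)
    have hM : Function.Injective M :=
      hQ (c t) ⟨Real.smoothTransition.nonneg _, Real.smoothTransition.le_one _⟩
    have hHM : (fun x => H (t, x)) = M := by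
      ext1 x
      simp [H, M, hat, hg₀]
    rw [hHM]
    exact ⟨hM, fun x => by rwa [M.fderiv]⟩
  · have hct : c t = 0 := by
      refine Real.smoothTransition.zero_of_nonpos (not_lt.1 fun h => hat ?_)
      simp [a, σ, Real.smoothTransition.one_of_one_le (x := 2 * t) (by linarith)]
    have hHf : (fun x => H (t, x)) = fun x => (a t)⁻¹ • (f (a t • x) - f 0) + a t • f 0 := by
      ext1 x
      simp [H, hct, hfg, hat]
    rw [hHf]
    refine ⟨fun x y hxy => ?_, fun x => ?_⟩
    · have h : f (a t • x) = f (a t • y) := by simpa [hat] using hxy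
      exact smul_right_injective _ hat (hinj h)
    · have hfx : HasFDerivAt f (fderiv ℝ f (a t • x)) (a t • x) :=
        (hf.differentiable (by simp) _).hasFDerivAt
      have hd := (((hfx.comp x ((hasFDerivAt_id x).const_smul (a t))).sub_const
        (f 0)).const_smul (a t)⁻¹).add_const (a t • f 0)
      have hd' : HasFDerivAt (fun x => (a t)⁻¹ • (f (a t • x) - f 0) + a t • f 0)
          (fderiv ℝ f (a t • x)) x := hd.congr_fderiv (by ext1 y; simp [hat])
      rw [hd'.fderiv]
      exact himm _
end

section
/- Let E and F be finite-dimensional real normed vector spaces and let f : E → F be a smooth (C^∞) map with f(0) = 0. Define H : ℝ × E → F by H(s,x) = s⁻¹ · f(s·x) for s ≠ 0 and H(0,x) = Df_0(x), where Df_0 is the derivative of f at 0. Then H is smooth on all of ℝ × E. Moreover, if E = F, if f is injective and open, and if Df_0 is a linear automorphism of E, then H(s,·) : E → E is injective and open for every s ∈ ℝ. -/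
open MeasureTheory Metric in
/-- Differentiation under the integral sign for a `C¹` integrand on a compact interval. -/
theorem ContDiff.hasFDerivAt_intervalIntegral
    {P F : Type*} [NormedAddCommGroup P] [NormedSpace ℝ P] [ProperSpace P]
    [NormedAddCommGroup F] [NormedSpace ℝ F]
    {φ : P × ℝ → F} (hφ : ContDiff ℝ 1 φ) (a b : ℝ) (p : P) :
    HasFDerivAt (fun p => ∫ t in a..b, φ (p, t))
      (∫ t in a..b, (fderiv ℝ φ (p, t)).comp (ContinuousLinearMap.inl ℝ P ℝ)) p := by
  have hc : Continuous fun q : P × ℝ => (fderiv ℝ φ q).comp (ContinuousLinearMap.inl ℝ P ℝ) :=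
    (hφ.continuous_fderiv one_ne_zero).clm_comp continuous_const
  obtain ⟨C, hC⟩ := ((isCompact_closedBall p 1).prod (isCompact_uIcc (a := a) (b := b)))
    |>.exists_bound_of_continuousOn hc.continuousOn
  refine intervalIntegral.hasFDerivAt_integral_of_dominated_of_fderiv_le
    (F := fun p t => φ (p, t))
    (F' := fun p t => (fderiv ℝ φ (p, t)).comp (ContinuousLinearMap.inl ℝ P ℝ))
    (bound := fun _ => C) (closedBall_mem_nhds p one_pos) ?_ ?_ ?_ ?_ ?_ ?_
  · exact .of_forall fun x =>
      (hφ.continuous.comp (Continuous.prodMk_right x)).aestronglyMeasurable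
  · exact (hφ.continuous.comp (Continuous.prodMk_right p)).intervalIntegrable a b
  · exact (hc.comp (Continuous.prodMk_right p)).aestronglyMeasurable
  · exact .of_forall fun t ht x hx => hC (x, t) ⟨hx, Set.uIoc_subset_uIcc ht⟩
  · exact intervalIntegrable_const
  · exact .of_forall fun t _ x _ =>
      ((hφ.differentiable one_ne_zero) (x, t)).hasFDerivAt.comp x (hasFDerivAt_prodMk_left x t)

/-- The integral of a smooth function over a compact interval depends smoothly on parameters. -/
theorem ContDiff.intervalIntegral_param
    {P F : Type*} [NormedAddCommGroup P] [NormedSpace ℝ P] [FiniteDimensional ℝ P]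
    [NormedAddCommGroup F] [NormedSpace ℝ F] [CompleteSpace F] (a b : ℝ)
    {φ : P × ℝ → F} (hφ : ContDiff ℝ (⊤ : ℕ∞) φ) :
    ContDiff ℝ (⊤ : ℕ∞) fun p => ∫ t in a..b, φ (p, t) := by
  have : ProperSpace P := FiniteDimensional.proper ℝ P
  refine contDiff_infty.2 fun n => ?_
  induction n generalizing φ with
  | zero =>
    exact contDiff_zero.2 (continuous_iff_continuousAt.2 fun p =>
      ((hφ.of_le (by simp)).hasFDerivAt_intervalIntegral a b p).continuousAt)
  | succ n ih =>
    have hφ1 : ContDiff ℝ 1 φ := hφ.of_le (by simp)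
    have hd := hφ1.hasFDerivAt_intervalIntegral a b
    rw [Nat.cast_add, Nat.cast_one, contDiff_succ_iff_fderiv_apply]
    refine ⟨fun p => (hd p).differentiableAt, by simp, fun v => ?_⟩
    have hint : (fun p => fderiv ℝ (fun p => ∫ t in a..b, φ (p, t)) p v) =
        fun p => ∫ t in a..b, fderiv ℝ φ (p, t) (v, 0) := by
      ext p
      rw [(hd p).fderiv, ContinuousLinearMap.intervalIntegral_apply]
      · simp
      · exact (((hφ1.continuous_fderiv one_ne_zero).comp
          (Continuous.prodMk_right p)).clm_comp continuous_const).intervalIntegrable a b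
    rw [hint]
    exact ih (φ := fun q => fderiv ℝ φ q (v, 0))
      ((hφ.fderiv_right (by simp)).clm_apply contDiff_const)


/-- **Smoothness of the scaling construction.**
Let `E`, `F` be finite-dimensional real normed vector spaces and `f : E → F` smooth with
`f 0 = 0`.  Define `H : ℝ × E → F` by `H (s, x) = s⁻¹ • f (s • x)` for `s ≠ 0` and
`H (0, x) = Df₀ x`.  Then `H` is smooth on all of `ℝ × E`.  Moreover, in the case `E = F`,
if `f` is injective and open and `Df₀` is a linear automorphism, then `H (s, ·)` is injective
and open for every `s`. -/
theorem smooth_scaling_family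
    {E F : Type*} [NormedAddCommGroup E] [NormedSpace ℝ E] [FiniteDimensional ℝ E]
    [NormedAddCommGroup F] [NormedSpace ℝ F] [FiniteDimensional ℝ F]
    (f : E → F) (hf : ContDiff ℝ (⊤ : ℕ∞) f) (hf0 : f 0 = 0)
    (H : ℝ × E → F)
    (hH : ∀ s : ℝ, s ≠ 0 → ∀ x : E, H (s, x) = s⁻¹ • f (s • x))
    (hH0 : ∀ x : E, H (0, x) = fderiv ℝ f 0 x) :
    ContDiff ℝ (⊤ : ℕ∞) H ∧
    (∀ (g : E → E), ContDiff ℝ (⊤ : ℕ∞) g → g 0 = 0 →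
      ∀ G : ℝ × E → E,
        (∀ s : ℝ, s ≠ 0 → ∀ x : E, G (s, x) = s⁻¹ • g (s • x)) →
        (∀ x : E, G (0, x) = fderiv ℝ g 0 x) →
        Function.Injective g → IsOpenMap g →
        Function.Bijective (fderiv ℝ g 0) →
        ∀ s : ℝ, Function.Injective (fun x => G (s, x)) ∧ IsOpenMap (fun x => G (s, x))) := by
  refine ⟨?_, fun g _ _ G hG hG0 hinj hopen hbij s => ?_⟩
  · have hint : H = fun p : ℝ × E => ∫ t in (0 : ℝ)..1, fderiv ℝ f (t • p.1 • p.2) p.2 := by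
      ext ⟨s, x⟩
      rcases eq_or_ne s 0 with rfl | hs
      · simp [hH0]
      have hderiv (t : ℝ) : HasDerivAt (fun t : ℝ => s⁻¹ • f (t • s • x))
          (fderiv ℝ f (t • s • x) x) t := by
        have h := ((hf.differentiable (by simp) (t • s • x)).hasFDerivAt.comp_hasDerivAt t
          ((hasDerivAt_id t).smul_const (s • x))).const_smul s⁻¹
        convert h using 1
        · rfl
        · simp [hs]
      have hcont : Continuous fun t : ℝ => fderiv ℝ f (t • s • x) x :=
        ((hf.continuous_fderiv (by simp)).comp (by fun_prop)).clm_apply continuous_const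
      rw [intervalIntegral.integral_eq_sub_of_hasDerivAt (fun t _ => hderiv t)
        (hcont.intervalIntegrable 0 1), hH s hs]
      simp [hf0]
    rw [hint]
    refine ContDiff.intervalIntegral_param 0 1
      (φ := fun q : (ℝ × E) × ℝ => fderiv ℝ f (q.2 • q.1.1 • q.1.2) q.1.2) ?_
    exact ((hf.fderiv_right (m := (⊤ : ℕ∞)) (by simp)).comp (by fun_prop)).clm_apply (by fun_prop)
  · rcases eq_or_ne s 0 with rfl | hs
    · simp only [hG0]
      exact ⟨hbij.1, (fderiv ℝ g 0).isOpenMap_of_finiteDimensional hbij.2⟩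
    · simp only [hG s hs]
      exact ⟨(smul_right_injective E (inv_ne_zero hs)).comp
          (hinj.comp (smul_right_injective E hs)),
        (isOpenMap_smul₀ (inv_ne_zero hs)).comp (hopen.comp (isOpenMap_smul₀ hs))⟩
end

section
/- Let E and F be finite-dimensional real normed vector spaces and let f : E → F be a function. Then f is continuously differentiable (C¹) if and only if there exists a continuous map g : ℝ≥0 × E × E → F such that g(t,v,u) = t⁻¹ · ( f(u + t·v) − f(u) ) for all t > 0 and all u, v ∈ E. In that case g is unique, g(0,v,u) = Df_u(v) for all u, v ∈ E (where Df_u is the derivative of f at u), and in particular for every u the map v ↦ g(0,v,u) is linear. -/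
open scoped NNReal

/-- The difference-quotient property of `g : ℝ≥0 × E × E → F` relative to `f : E → F`:
`g` is continuous and `g (t, v, u) = t⁻¹ • (f (u + t • v) - f u)` for all `t > 0`. -/
def IsDiffQuotExtension {E F : Type*} [NormedAddCommGroup E] [NormedSpace ℝ E]
    [NormedAddCommGroup F] [NormedSpace ℝ F] (f : E → F) (g : ℝ≥0 × E × E → F) : Prop :=
  Continuous g ∧
    ∀ t : ℝ≥0, 0 < t → ∀ v u : E, g (t, v, u) = (t : ℝ)⁻¹ • (f (u + (t : ℝ) • v) - f u)

theorem NNReal.dense_Ioi_zero : Dense (Set.Ioi (0 : ℝ≥0)) := by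
  intro t
  rw [closure_Ioi' ⟨1, one_pos⟩]
  exact Set.mem_Ici.2 (zero_le (a := t))

namespace IsDiffQuotExtension

variable {E F : Type*} [NormedAddCommGroup E] [NormedSpace ℝ E]
  [NormedAddCommGroup F] [NormedSpace ℝ F] {f : E → F} {g g' : ℝ≥0 × E × E → F}

theorem unique (hg : IsDiffQuotExtension f g) (hg' : IsDiffQuotExtension f g') : g = g' := by
  refine Continuous.ext_on (NNReal.dense_Ioi_zero.preimage isOpenMap_fst) hg.1 hg'.1 ?_
  rintro ⟨t, v, u⟩ ht
  rw [hg.2 t ht, hg'.2 t ht]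

theorem map_add (hg : IsDiffQuotExtension f g) (t : ℝ≥0) (v w u : E) :
    g (t, v + w, u) = g (t, v, u + (t : ℝ) • w) + g (t, w, u) := by
  have hc := hg.1
  have key : (fun t : ℝ≥0 => g (t, v + w, u)) =
      fun t : ℝ≥0 => g (t, v, u + (t : ℝ) • w) + g (t, w, u) := by
    refine Continuous.ext_on NNReal.dense_Ioi_zero (by fun_prop) (by fun_prop) fun t ht => ?_
    simp only [hg.2 t ht]
    rw [← smul_add, sub_add_sub_cancel, smul_add, add_assoc, add_comm ((t : ℝ) • w)]
  exact congrFun key t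

/-- The value of a difference-quotient extension at time `0`, as a continuous linear map. -/
noncomputable def derivAtZero (hg : IsDiffQuotExtension f g) (u : E) : E →L[ℝ] F :=
  AddMonoidHom.toRealLinearMap
    (AddMonoidHom.mk' (fun v => g (0, v, u)) fun v w => by simpa using hg.map_add 0 v w u)
    (hg.1.comp (by fun_prop : Continuous fun v : E => ((0 : ℝ≥0), v, u)))

theorem derivAtZero_apply (hg : IsDiffQuotExtension f g) (u v : E) :
    hg.derivAtZero u v = g (0, v, u) := rfl

theorem sub_eq_smul (hg : IsDiffQuotExtension f g) {t : ℝ≥0} (ht : 0 < t) (v u : E) :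
    f (u + (t : ℝ) • v) - f u = (t : ℝ) • g (t, v, u) := by
  rw [hg.2 t ht, smul_inv_smul₀ (by exact_mod_cast ht.ne')]

theorem hasFDerivAt [FiniteDimensional ℝ E] (hg : IsDiffQuotExtension f g) (u : E) :
    HasFDerivAt f (hg.derivAtZero u) u := by
  have hc := hg.1
  rw [hasFDerivAt_iff_isLittleO_nhds_zero, Asymptotics.isLittleO_iff]
  intro ε hε
  have : ProperSpace E := FiniteDimensional.proper ℝ E
  have unif : ∀ᶠ t : ℝ≥0 in nhds 0, ∀ v ∈ Metric.sphere (0 : E) 1,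
      ‖g (t, v, u) - g (0, v, u)‖ < ε := by
    refine (isCompact_sphere (0 : E) 1).eventually_forall_of_forall_eventually fun v _ => ?_
    have hcont : Continuous fun z : ℝ≥0 × E => ‖g (z.1, z.2, u) - g (0, z.2, u)‖ := by
      fun_prop
    exact hcont.continuousAt.eventually_lt continuousAt_const (by simpa using hε)
  have hnorm : Filter.Tendsto (fun h : E => ‖h‖₊) (nhds 0) (nhds 0) := by
    simpa using (continuous_nnnorm (E := E)).tendsto 0
  filter_upwards [hnorm.eventually unif] with h hh
  rcases eq_or_ne h 0 with rfl | hne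
  · simp
  have hpos : 0 < ‖h‖₊ := nnnorm_pos.2 hne
  have hsmul : (‖h‖₊ : ℝ) • ((‖h‖⁻¹ : ℝ) • h) = h := by
    simp [smul_smul, norm_ne_zero_iff.2 hne]
  have hdir := hh ((‖h‖⁻¹ : ℝ) • h) (by simp [norm_smul, norm_ne_zero_iff.2 hne])
  have hlin : hg.derivAtZero u h = (‖h‖₊ : ℝ) • g (0, (‖h‖⁻¹ : ℝ) • h, u) := by
    rw [← derivAtZero_apply hg, ← map_smul, hsmul]
  have hsub := hg.sub_eq_smul hpos ((‖h‖⁻¹ : ℝ) • h) u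
  rw [hsmul] at hsub
  rw [hsub, hlin, ← smul_sub, norm_smul, coe_nnnorm, norm_norm, mul_comm]
  gcongr

theorem contDiff [FiniteDimensional ℝ E] (hg : IsDiffQuotExtension f g) : ContDiff ℝ 1 f := by
  rw [contDiff_one_iff_fderiv]
  refine ⟨fun u => (hg.hasFDerivAt u).differentiableAt, continuous_clm_apply.2 fun v => ?_⟩
  have hc := hg.1
  simp only [(hg.hasFDerivAt _).fderiv, derivAtZero_apply]
  fun_prop

end IsDiffQuotExtension

theorem ContDiff.exists_isDiffQuotExtension {E F : Type*} [NormedAddCommGroup E]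
    [NormedSpace ℝ E] [NormedAddCommGroup F] [NormedSpace ℝ F] [CompleteSpace F]
    {f : E → F} (hf : ContDiff ℝ 1 f) : ∃ g : ℝ≥0 × E × E → F, IsDiffQuotExtension f g := by
  obtain ⟨hd, hc⟩ := contDiff_one_iff_fderiv.1 hf
  refine ⟨fun p => ∫ s in (0 : ℝ)..1, fderiv ℝ f (p.2.2 + (s * p.1) • p.2.1) p.2.1, ?_, ?_⟩
  · apply intervalIntegral.continuous_parametric_intervalIntegral_of_continuous'
    fun_prop
  · intro t ht v u
    rw [eq_inv_smul_iff₀ (by exact_mod_cast ht.ne'), ← intervalIntegral.integral_smul]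
    have hderiv (s : ℝ) : HasDerivAt (fun s : ℝ => f (u + (s * t) • v))
        ((t : ℝ) • fderiv ℝ f (u + (s * t) • v) v) s := by
      have hline : HasDerivAt (fun s : ℝ => u + (s * t) • v) ((t : ℝ) • v) s := by
        simpa using (((hasDerivAt_id s).mul_const (t : ℝ)).smul_const v).const_add u
      simpa [Function.comp_def] using (hd _).hasFDerivAt.comp_hasDerivAt s hline
    rw [intervalIntegral.integral_eq_sub_of_hasDerivAt (fun s _ => hderiv s)]
    · simp
    · exact Continuous.intervalIntegrable (by fun_prop) _ _

/-- **`C¹` maps are exactly those with a continuous extension of the difference quotients.**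
Let `E`, `F` be finite-dimensional real normed vector spaces.  A map `f : E → F` is `C¹` if and
only if there is a continuous `g : ℝ≥0 × E × E → F` with
`g (t, v, u) = t⁻¹ • (f (u + t • v) - f u)` for `t > 0`.  In that case `g` is unique,
`g (0, v, u) = Df_u v`, and in particular `v ↦ g (0, v, u)` is linear for every `u`. -/
theorem contDiffOne_iff_diffQuot_extension
    {E F : Type*} [NormedAddCommGroup E] [NormedSpace ℝ E] [FiniteDimensional ℝ E]
    [NormedAddCommGroup F] [NormedSpace ℝ F] [FiniteDimensional ℝ F] (f : E → F) :
    (ContDiff ℝ 1 f ↔ ∃ g : ℝ≥0 × E × E → F, IsDiffQuotExtension f g) ∧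
    (∀ g g' : ℝ≥0 × E × E → F,
      IsDiffQuotExtension f g → IsDiffQuotExtension f g' → g = g') ∧
    (∀ g : ℝ≥0 × E × E → F, IsDiffQuotExtension f g →
      (∀ u v : E, g (0, v, u) = fderiv ℝ f u v) ∧
      (∀ u : E, IsLinearMap ℝ fun v => g (0, v, u))) := by
  have : CompleteSpace F := FiniteDimensional.complete ℝ F
  refine ⟨⟨fun hf => hf.exists_isDiffQuotExtension, fun ⟨_, hg⟩ => hg.contDiff⟩,
    fun _ _ hg hg' => hg.unique hg', fun g hg => ⟨fun u v => ?_, fun u => ?_⟩⟩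
  · rw [(hg.hasFDerivAt u).fderiv, hg.derivAtZero_apply]
  · exact (hg.derivAtZero u).toLinearMap.isLinear
end
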